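/- arXiv:2304.00922 — 3 statements merged into one kernel-verified Lean document; each statement's English description precedes it below -/
import Mathlib

section
/- Let k be an even positive integer, let γ be the smallest positive integer that does not divide k, and let n ≥ 2(k+γ). (1) If γ divides n then m(1,J(n,k)) ≤ (⌊γ/2⌋+1)·k + 1. (2) If γ does not divide n then m(1,J(n,k)) ≤ (⌊γ/2⌋+1)·(2k+β−1) + 1, where β is the remainder of n−(k+1) upon division by γ. -/
/-- `u` is `k`-feasible: coordinates sum to zero and the sum over every `k`-element
subset is a nonzero integer. -/
def KFeasible (n k : ℕ) (u : Fin n → ℝ) : Prop :=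
  (∑ i, u i = 0) ∧
  ∀ A : Finset (Fin n), A.card = k → ∃ z : ℤ, z ≠ 0 ∧ ∑ i ∈ A, u i = z

/-- `max_A |s_u(A)|` over the `k`-element subsets `A` of `Fin n`. -/
noncomputable def maxNormJ (n k : ℕ) (u : Fin n → ℝ) : ℝ :=
  ⨆ A : {A : Finset (Fin n) // A.card = k}, |∑ i ∈ A.1, u i|

/-- `m(1, J(n,k))`: infimum in `ℕ` of `1 + max_A |s_u(A)|` over `k`-feasible `u`. -/
noncomputable def mJ (n k : ℕ) : ℕ :=
  sInf {m : ℕ | ∃ u : Fin n → ℝ, KFeasible n k u ∧ (m : ℝ) = 1 + maxNormJ n k u}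

lemma mJ_le_of_int (n k B : ℕ) (hkn : k ≤ n) (w : Fin n → ℤ) (hs : ∑ i, w i = 0)
    (h : ∀ A : Finset (Fin n), A.card = k → ∑ i ∈ A, w i ≠ 0 ∧ |∑ i ∈ A, w i| ≤ B) :
    mJ n k ≤ B + 1 := by
  obtain ⟨A0, -, hA0⟩ := Finset.exists_subset_card_eq
    (show k ≤ (Finset.univ : Finset (Fin n)).card by simpa using hkn)
  have : Nonempty {A : Finset (Fin n) // A.card = k} := ⟨⟨A0, hA0⟩⟩
  obtain ⟨A, hA⟩ := exists_eq_ciSup_of_finite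
    (f := fun A : {A : Finset (Fin n) // A.card = k} => |∑ i ∈ A.1, ((w i : ℤ) : ℝ)|)
  have hB := (h A.1 A.2).2
  have hmem : (1 + (∑ i ∈ A.1, w i).natAbs) ∈
      {m : ℕ | ∃ u : Fin n → ℝ, KFeasible n k u ∧ (m : ℝ) = 1 + maxNormJ n k u} := by
    refine ⟨fun i => (w i : ℝ), ⟨by beta_reduce; exact_mod_cast hs, fun C hC => ⟨∑ i ∈ C, w i, (h C hC).1, by
      push_cast; rfl⟩⟩, ?_⟩
    unfold maxNormJ
    rw [← hA, Nat.cast_add, Nat.cast_natAbs]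
    push_cast
    rfl
  have := Nat.sInf_le hmem
  unfold mJ
  rw [Int.abs_eq_natAbs] at hB
  omega

lemma two_val_sum {N : ℕ} (c γ : ℤ) (hγ : 0 ≤ γ) (A : Finset (Fin N)) (w : Fin N → ℤ)
    (h : ∀ i ∈ A, w i = c ∨ w i = c - γ) :
    ∑ i ∈ A, w i ≤ c * A.card ∧ (c - γ) * A.card ≤ ∑ i ∈ A, w i ∧
      γ ∣ c * A.card - ∑ i ∈ A, w i := by
  have e : ∀ d : ℤ, d * A.card = ∑ i ∈ A, d := by intro d; simp [mul_comm]
  rw [e, e, ← Finset.sum_sub_distrib]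
  refine ⟨Finset.sum_le_sum fun i hi => ?_, Finset.sum_le_sum fun i hi => ?_,
    Finset.dvd_sum fun i hi => ?_⟩
  · rcases h i hi with h | h <;> omega
  · rcases h i hi with h | h <;> omega
  · rcases h i hi with h | h <;> simp [h]

lemma step_sum (N b : ℕ) (hb : b ≤ N) (c γ : ℤ) :
    ∑ i : Fin N, (if i.val < b then c - γ else c) = N * c - b * γ := by
  have : ∀ i : Fin N, (if i.val < b then c - γ else c) = c - (if i.val < b then γ else 0) := by
    intro i; split_ifs <;> simp
  simp_rw [this]
  rw [Finset.sum_sub_distrib, Fin.sum_univ_eq_sum_range (fun i => if i < b then γ else 0) N,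
    ← Finset.sum_filter]
  have : (Finset.range N).filter (fun i => i < b) = Finset.range b := by
    ext i; simp; omega
  rw [this]; simp

theorem mJ_even_k (n k γ : ℕ) (hk : 0 < k) (hkeven : Even k)
    (hγpos : 0 < γ) (hγndvd : ¬ γ ∣ k) (hγmin : ∀ m : ℕ, 0 < m → m < γ → m ∣ k)
    (hn : 2 * (k + γ) ≤ n) :
    (γ ∣ n → mJ n k ≤ (γ / 2 + 1) * k + 1) ∧
    (¬ γ ∣ n → mJ n k ≤ (γ / 2 + 1) * (2 * k + (n - (k + 1)) % γ - 1) + 1) := by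
  have hγ3 : 3 ≤ γ := by
    by_contra hlt
    have : γ = 1 ∨ γ = 2 := by omega
    rcases this with rfl | rfl
    · exact hγndvd (one_dvd _)
    · exact hγndvd hkeven.two_dvd
  have hcop : Nat.Coprime γ (γ / 2 + 1) := by
    rcases Nat.even_or_odd' γ with ⟨m, hm | hm⟩
    · have hme : 2 ∣ m := by
        by_contra hmo
        apply hγndvd
        rw [hm]
        exact Nat.Coprime.mul_dvd_of_dvd_of_dvd
          ((Nat.Prime.coprime_iff_not_dvd Nat.prime_two).2 hmo) hkeven.two_dvd
          (hγmin m (by omega) (by omega))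
      have : γ / 2 + 1 = m + 1 := by omega
      rw [this, hm]
      refine Nat.Coprime.mul_left ?_ (by simp)
      exact (Nat.Prime.coprime_iff_not_dvd Nat.prime_two).2 (by omega)
    · have h1 : γ = m + (m + 1) := by omega
      have h2 : γ / 2 + 1 = m + 1 := by omega
      rw [h2, h1]
      simp
  have hcle : γ / 2 + 1 ≤ γ := by omega
  have hc2 : γ ≤ 2 * (γ / 2 + 1) := by omega
  generalize γ / 2 + 1 = c at *
  have hcz : (c : ℤ) ≤ γ := by exact_mod_cast hcle
  have hc2z : (γ : ℤ) ≤ 2 * c := by exact_mod_cast hc2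
  have hkz : (1 : ℤ) ≤ k := by exact_mod_cast hk
  have key : ∀ (w : Fin n → ℤ) (A : Finset (Fin n)), A.card = k →
      (∀ i ∈ A, w i = (c : ℤ) ∨ w i = (c : ℤ) - γ) →
      ∑ i ∈ A, w i ≠ 0 ∧ |∑ i ∈ A, w i| ≤ (c : ℤ) * k := by
    intro w A hA hw
    obtain ⟨h1, h2, h3⟩ := two_val_sum (c : ℤ) γ (by positivity) A w hw
    rw [hA] at h1 h2 h3
    constructor
    · intro h0
      rw [h0, sub_zero] at h3
      exact hγndvd (hcop.dvd_of_dvd_mul_left (by exact_mod_cast h3))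
    · rw [abs_le]
      constructor
      · nlinarith
      · exact h1
  constructor
  · rintro ⟨t, ht⟩
    refine mJ_le_of_int n k (c * k) (by omega)
      (fun i => if i.val < c * t then (c : ℤ) - γ else c) ?_ ?_
    · rw [step_sum n (c * t) (by rw [ht]; exact Nat.mul_le_mul_right _ hcle), ht]
      push_cast; ring
    · intro A hA
      have := key (fun i => if i.val < c * t then (c : ℤ) - γ else c) A hA
        (fun i _ => by split_ifs <;> simp)
      exact_mod_cast this
  · intro _
    have hdm := Nat.div_add_mod (n - (k + 1)) γ
    generalize (n - (k + 1)) % γ = β at *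
    generalize (n - (k + 1)) / γ = q at *
    obtain ⟨N, rfl⟩ : ∃ N, n = N + 1 := ⟨n - 1, by omega⟩
    have hN : N = γ * q + β + k := by omega
    have hb : c * q ≤ N := by
      have := Nat.mul_le_mul_right q hcle
      omega
    let w : Fin (N + 1) → ℤ := Fin.cons (-((c : ℤ) * (k + β)))
      (fun i : Fin N => if i.val < c * q then (c : ℤ) - γ else c)
    have hw : ∀ i, i ≠ 0 → w i = (c : ℤ) ∨ w i = (c : ℤ) - γ := by
      intro i hi
      obtain ⟨j, rfl⟩ := Fin.exists_succ_eq.2 hi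
      simp only [w, Fin.cons_succ]
      split_ifs <;> simp
    have hBz : ((c * (2 * k + β - 1) : ℕ) : ℤ) = (c : ℤ) * (2 * k + β - 1) := by
      rw [Nat.cast_mul, Nat.cast_sub (by omega)]; push_cast; ring
    have hc0 : (1 : ℤ) ≤ c := by omega
    have hβ0 : (0 : ℤ) ≤ β := by positivity
    refine mJ_le_of_int (N + 1) k _ (by omega) w ?_ ?_
    · rw [Fin.sum_univ_succ]
      simp only [w, Fin.cons_succ, Fin.cons_zero]
      rw [step_sum N (c * q) hb, hN]
      push_cast; ring
    · intro A hA
      rw [hBz]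
      by_cases h0 : (0 : Fin (N + 1)) ∈ A
      · have hcard : ((A.erase 0).card : ℤ) = k - 1 := by
          rw [Finset.card_erase_of_mem h0, hA, Nat.cast_sub hk]; simp
        obtain ⟨h1, h2, -⟩ := two_val_sum (c : ℤ) γ (by positivity) (A.erase 0) w
          (fun i hi => hw i (Finset.ne_of_mem_erase hi))
        rw [hcard] at h1 h2
        rw [← Finset.add_sum_erase A w h0]
        have hw0 : w 0 = -((c : ℤ) * (k + β)) := rfl
        rw [hw0]
        generalize ∑ i ∈ A.erase 0, w i = s at *
        have hcb : 0 ≤ (c : ℤ) * β := by positivity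
        have hneg : -((c : ℤ) * (k + β)) + s < 0 := by nlinarith
        refine ⟨hneg.ne, ?_⟩
        rw [abs_of_neg hneg]
        nlinarith
      · obtain ⟨h1, h2⟩ := key w A hA (fun i hi => hw i (fun h => h0 (h ▸ hi)))
        refine ⟨h1, h2.trans ?_⟩
        apply mul_le_mul_of_nonneg_left <;> omega
end

section
/- Let k ≥ 2 and n > T(k). Then m(1,J(n,k)) ≥ N(n,k) + 1; equivalently, for every k-feasible u : Fin n → ℝ one has max_A |s_u(A)| ≥ N(n,k), where A ranges over the k-element subsets of Fin n. -/
/-- `γ(k)`: the smallest positive integer that does not divide `k`. -/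
noncomputable def gammaF (k : ℕ) : ℕ := sInf {m : ℕ | 0 < m ∧ ¬ m ∣ k}

/-- `j(k) = 2k` for odd `k`, and `j(k) = (⌊γ(k)/2⌋+1)(2k+γ(k))` for even `k`. -/
noncomputable def jF (k : ℕ) : ℕ :=
  if Odd k then 2 * k else (gammaF k / 2 + 1) * (2 * k + gammaF k)

/-- `T(k) = j(k)² + 2k·j(k) + 3k − j(k) − j(k)²/k`, a rational number. -/
noncomputable def TF (k : ℕ) : ℚ :=
  (jF k : ℚ) ^ 2 + 2 * (k : ℚ) * (jF k : ℚ) + 3 * (k : ℚ) - (jF k : ℚ)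
    - (jF k : ℚ) ^ 2 / (k : ℚ)

/-- `(a,b,r,s) ∈ B(n,k)`. -/
def InB (n k a b r s : ℕ) : Prop :=
  b ≠ 0 ∧ r < s ∧ Nat.gcd r s = 1 ∧ s ∣ Nat.gcd n k ∧
    ¬ ∃ z : ℤ, (k : ℝ) * ((b : ℝ) * (s : ℝ) - (r : ℝ)) /
      ((s : ℝ) * ((a : ℝ) + (b : ℝ))) = z

/-- `N(n,k) = min over (a,b,r,s) ∈ B(n,k) of max{k(a + r/s), k(b − r/s)}`. -/
noncomputable def Nval (n k : ℕ) : ℝ :=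
  sInf {x : ℝ | ∃ a b r s : ℕ, InB n k a b r s ∧
    x = max ((k : ℝ) * ((a : ℝ) + (r : ℝ) / (s : ℝ)))
            ((k : ℝ) * ((b : ℝ) - (r : ℝ) / (s : ℝ)))}

lemma core_aux (n k g : ℕ) (u : Fin n → ℝ) (hk : 2 ≤ k) (hgk : g ≤ k)
    (hn : (k : ℝ) * (k - 1) * (g + 1) ^ 2 + (2 * k - 1) * k * (g + 1) + 3 * k < n)
    (hsum : ∑ i, u i = 0)
    (hint : ∀ i j, ∃ z : ℤ, u i - u j = z)
    (hkint : ∀ i, ∃ z : ℤ, (k : ℝ) * u i = z)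
    (hb : ∀ A : Finset (Fin n), A.card = k → |∑ i ∈ A, u i| ≤ k * g)
    (hpop : ∀ x : ℝ, x ≤ 0 → (Finset.univ.filter (fun i => u i = x)).card < k) : False := by
  have hkR : (2 : ℝ) ≤ k := by exact_mod_cast hk
  have hgR : (0 : ℝ) ≤ g := by positivity
  have hgkR : (g : ℝ) ≤ k := by exact_mod_cast hgk
  set L := Finset.univ.filter (fun i => u i < -(g : ℝ)) with hLdef
  set Q := Finset.univ.filter (fun i => -(g : ℝ) ≤ u i ∧ u i ≤ 0) with hQdef
  set P := Finset.univ.filter (fun i => 0 < u i) with hPdef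
  set G := Finset.univ.filter (fun i => (g : ℝ) < u i) with hGdef
  set R := Finset.univ.filter (fun i => -(g : ℝ) ≤ u i ∧ u i ≤ g) with hRdef
  have hL : L.card < k := by
    by_contra hcon
    push Not at hcon
    obtain ⟨A, hA, hAc⟩ := Finset.exists_subset_card_eq hcon
    have hne : A.Nonempty := by
      rw [← Finset.card_pos]; omega
    have h1 : ∑ i ∈ A, u i < ∑ i ∈ A, (-(g : ℝ)) := by
      apply Finset.sum_lt_sum_of_nonempty hne
      intro i hi
      exact (Finset.mem_filter.mp (hA hi)).2
    rw [Finset.sum_const, hAc, nsmul_eq_mul] at h1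
    have h2 := (abs_le.mp (hb A hAc)).1
    linarith
  have hG : G.card < k := by
    by_contra hcon
    push Not at hcon
    obtain ⟨A, hA, hAc⟩ := Finset.exists_subset_card_eq hcon
    have hne : A.Nonempty := by
      rw [← Finset.card_pos]; omega
    have h1 : ∑ i ∈ A, (g : ℝ) < ∑ i ∈ A, u i := by
      apply Finset.sum_lt_sum_of_nonempty hne
      intro i hi
      exact (Finset.mem_filter.mp (hA hi)).2
    rw [Finset.sum_const, hAc, nsmul_eq_mul] at h1
    have h2 := (abs_le.mp (hb A hAc)).2
    linarith
  have hn3 : 3 * k < n := by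
    have h0 : 0 ≤ (k : ℝ) * (k - 1) * (g + 1) ^ 2 :=
      mul_nonneg (mul_nonneg (by linarith) (by linarith)) (by positivity)
    have h1 : 0 ≤ (2 * (k : ℝ) - 1) * k * (g + 1) :=
      mul_nonneg (mul_nonneg (by linarith) (by linarith)) (by positivity)
    have : (3 : ℝ) * k < n := by linarith
    exact_mod_cast this
  have hR : k ≤ R.card := by
    have hcov : (Finset.univ : Finset (Fin n)) ⊆ L ∪ G ∪ R := by
      intro i _
      simp only [hLdef, hGdef, hRdef, Finset.mem_union, Finset.mem_filter, Finset.mem_univ,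
        true_and]
      by_cases h1 : u i < -(g : ℝ)
      · exact Or.inl (Or.inl h1)
      · by_cases h2 : (g : ℝ) < u i
        · exact Or.inl (Or.inr h2)
        · exact Or.inr ⟨not_lt.mp h1, not_lt.mp h2⟩
    have h1 := Finset.card_le_card hcov
    have h2 := Finset.card_union_le (L ∪ G) R
    have h3 := Finset.card_union_le L G
    rw [Finset.card_univ, Fintype.card_fin] at h1
    omega
  have hSL : -(2 * (k : ℝ) * g) ≤ ∑ i ∈ L, u i := by
    obtain ⟨W, hW, hWc⟩ := Finset.exists_subset_card_eq (s := R) (n := k - L.card) (by omega)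
    have hdisj : Disjoint L W := by
      rw [Finset.disjoint_left]
      intro i hi hiW
      have h1 := (Finset.mem_filter.mp hi).2
      have h2 := (Finset.mem_filter.mp (hW hiW)).2.1
      linarith
    have hc : (L ∪ W).card = k := by
      rw [Finset.card_union_of_disjoint hdisj, hWc]; omega
    have h1 := (abs_le.mp (hb _ hc)).1
    rw [Finset.sum_union hdisj] at h1
    have h2 : ∑ i ∈ W, u i ≤ W.card • (g : ℝ) :=
      Finset.sum_le_card_nsmul _ _ _ (fun i hi => (Finset.mem_filter.mp (hW hi)).2.2)
    rw [nsmul_eq_mul] at h2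
    have h3 : (W.card : ℝ) ≤ k := by
      have : W.card ≤ k := by omega
      exact_mod_cast this
    have h4 := mul_le_mul_of_nonneg_right h3 hgR
    linarith
  have hQc : Q.card ≤ (k - 1) * (g + 1) := by
    have h := Finset.card_le_mul_card_image_of_maps_to (s := Q)
      (t := Finset.Icc (-(g : ℤ)) 0) (f := fun i => ⌈u i⌉) ?_ (k - 1) ?_
    · have hc : (Finset.Icc (-(g : ℤ)) 0).card = g + 1 := by
        rw [Int.card_Icc]; omega
      rwa [hc] at h
    · intro i hi
      have h1 := (Finset.mem_filter.mp hi).2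
      rw [Finset.mem_Icc]
      constructor
      · have : (-(g : ℝ)) ≤ (⌈u i⌉ : ℝ) := h1.1.trans (Int.le_ceil _)
        exact_mod_cast this
      · apply Int.ceil_le.mpr
        simpa using h1.2
    · intro m _
      rcases (Q.filter (fun i => ⌈u i⌉ = m)).eq_empty_or_nonempty with he | ⟨i, hi⟩
      · rw [he]; simp
      · have hi' := Finset.mem_filter.mp hi
        have hp := hpop (u i) (Finset.mem_filter.mp hi'.1).2.2
        have hsub : Q.filter (fun i => ⌈u i⌉ = m) ⊆ Finset.univ.filter (fun j => u j = u i) := by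
          intro j hj
          have hj' := Finset.mem_filter.mp hj
          refine Finset.mem_filter.mpr ⟨Finset.mem_univ _, ?_⟩
          obtain ⟨z, hz⟩ := hint j i
          have e : u j = u i + z := by linarith
          have h1 := hj'.2
          rw [e, Int.ceil_add_intCast, hi'.2] at h1
          have : z = 0 := by omega
          rw [e, this]; simp
        have := Finset.card_le_card hsub
        omega
  have hSQ : -((Q.card : ℝ) * g) ≤ ∑ i ∈ Q, u i := by
    have h2 : Q.card • (-(g : ℝ)) ≤ ∑ i ∈ Q, u i :=
      Finset.card_nsmul_le_sum _ _ _ (fun i hi => (Finset.mem_filter.mp hi).2.1)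
    rw [nsmul_eq_mul] at h2
    linarith
  have hSP : (P.card : ℝ) ≤ k * ∑ i ∈ P, u i := by
    rw [Finset.mul_sum]
    have h2 : P.card • (1 : ℝ) ≤ ∑ i ∈ P, (k : ℝ) * u i := by
      refine Finset.card_nsmul_le_sum _ _ _ (fun i hi => ?_)
      obtain ⟨z, hz⟩ := hkint i
      have h1 := (Finset.mem_filter.mp hi).2
      have h3 : 0 < (k : ℝ) * u i := by positivity
      rw [hz] at h3 ⊢
      have : 0 < z := by exact_mod_cast h3
      exact_mod_cast this
    simpa using h2
  have hd1 : Disjoint L Q := by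
    rw [Finset.disjoint_left]
    intro i hi hiW
    have h1 := (Finset.mem_filter.mp hi).2
    have h2 := (Finset.mem_filter.mp hiW).2.1
    linarith
  have hd2 : Disjoint (L ∪ Q) P := by
    rw [Finset.disjoint_left]
    intro i hi hiW
    have h2 := (Finset.mem_filter.mp hiW).2
    rcases Finset.mem_union.mp hi with h | h
    · have h1 := (Finset.mem_filter.mp h).2
      linarith
    · have h1 := (Finset.mem_filter.mp h).2.2
      linarith
  have hcov : (Finset.univ : Finset (Fin n)) = L ∪ Q ∪ P := by
    symm
    rw [Finset.eq_univ_iff_forall]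
    intro i
    simp only [hLdef, hQdef, hPdef, Finset.mem_union, Finset.mem_filter, Finset.mem_univ,
      true_and]
    by_cases h1 : u i < -(g : ℝ)
    · exact Or.inl (Or.inl h1)
    · by_cases h2 : 0 < u i
      · exact Or.inr h2
      · exact Or.inl (Or.inr ⟨not_lt.mp h1, not_lt.mp h2⟩)
  have hcard : n = L.card + Q.card + P.card := by
    rw [← Finset.card_union_of_disjoint hd1, ← Finset.card_union_of_disjoint hd2, ← hcov]
    simp
  have hs : ∑ i ∈ L, u i + ∑ i ∈ Q, u i + ∑ i ∈ P, u i = 0 := by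
    rw [← Finset.sum_union hd1, ← Finset.sum_union hd2, ← hcov, hsum]
  have hQcR : (Q.card : ℝ) ≤ (k - 1) * (g + 1) := by
    have : (Q.card : ℝ) ≤ (((k - 1) * (g + 1) : ℕ) : ℝ) := by exact_mod_cast hQc
    rw [Nat.cast_mul, Nat.cast_sub (by omega)] at this
    simpa using this
  have hLR : (L.card : ℝ) ≤ k - 1 := by
    have : (L.card : ℝ) + 1 ≤ k := by exact_mod_cast hL
    linarith
  have hcR : (n : ℝ) = L.card + Q.card + P.card := by exact_mod_cast hcard
  have h5 : ∑ i ∈ P, u i ≤ (k - 1) * (g + 1) * g + 2 * k * g := by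
    have := mul_le_mul_of_nonneg_right hQcR hgR
    linarith
  have h6 := mul_le_mul_of_nonneg_left h5 (by linarith : (0 : ℝ) ≤ k)
  have h7 : (k : ℝ) * (k - 1) * (g + 1) ^ 2 + (2 * k - 1) * k * (g + 1) + 3 * k
     < k * ((k - 1) * (g + 1) * g + 2 * k * g) + (k - 1) * (g + 1) + (k - 1) := by linarith
  have h8 : ((g : ℝ) + 1) * (k ^ 2 - 3 * k + 1) + 2 * k ^ 2 + 2 * k + 1 < 0 := by nlinarith
  nlinarith [mul_nonneg (by linarith : (0:ℝ) ≤ g + 1)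
    (mul_nonneg (by linarith : (0:ℝ) ≤ k - 2) (by linarith : (0:ℝ) ≤ k))]

lemma gamma_spec (k : ℕ) (hk : 2 ≤ k) : 2 ≤ gammaF k ∧ gammaF k ≤ k + 1 ∧ ¬ gammaF k ∣ k := by
  have hmem : k + 1 ∈ {m : ℕ | 0 < m ∧ ¬ m ∣ k} :=
    ⟨by omega, fun h => by have := Nat.le_of_dvd (by omega) h; omega⟩
  have h := Nat.sInf_mem ⟨_, hmem⟩
  have h1 : gammaF k ≤ k + 1 := Nat.sInf_le hmem
  have h2 : 0 < gammaF k ∧ ¬ gammaF k ∣ k := h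
  refine ⟨?_, h1, h2.2⟩
  by_contra hc
  have : gammaF k = 1 := by omega
  exact h2.2 (this ▸ one_dvd k)

lemma jF_ge (k : ℕ) : k * gammaF k ≤ jF k := by
  unfold jF
  split_ifs with h
  · have : gammaF k ≤ 2 := Nat.sInf_le ⟨by omega, fun h2 => by
      rw [← even_iff_two_dvd] at h2
      exact (Nat.not_even_iff_odd.mpr h) h2⟩
    nlinarith
  · have h1 : gammaF k ≤ 2 * (gammaF k / 2 + 1) := by omega
    nlinarith [Nat.zero_le ((gammaF k / 2 + 1) * gammaF k), Nat.mul_le_mul_left k h1]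

lemma T_bound (n k g : ℕ) (hk : 2 ≤ k) (hg : gammaF k = g + 1) (hn : TF k < (n : ℚ)) :
    (k : ℝ) * (k - 1) * (g + 1) ^ 2 + (2 * k - 1) * k * (g + 1) + 3 * k < n := by
  have hj := jF_ge k
  rw [hg] at hj
  have hjQ : (k : ℚ) * (g + 1) ≤ jF k := by exact_mod_cast hj
  have hkQ : (2 : ℚ) ≤ k := by exact_mod_cast hk
  have hgQ : (0 : ℚ) ≤ g := by positivity
  have key : (k : ℚ) * (k - 1) * (g + 1) ^ 2 + (2 * k - 1) * k * (g + 1) + 3 * k ≤ TF k := by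
    unfold TF
    set j : ℚ := (jF k : ℚ)
    have e : j ^ 2 + 2 * k * j + 3 * k - j - j ^ 2 / k
      = (k - 1) * (j ^ 2 / k) + (2 * k - 1) * j + 3 * k := by
      field_simp; ring
    rw [e]
    have h1 : (k : ℚ) * (g + 1) ^ 2 ≤ j ^ 2 / k := by
      rw [le_div_iff₀ (by linarith)]
      have : ((k : ℚ) * (g + 1)) ^ 2 ≤ j ^ 2 := by gcongr
      linarith
    have h2 := mul_le_mul_of_nonneg_left h1 (by linarith : (0 : ℚ) ≤ k - 1)
    have h3 := mul_le_mul_of_nonneg_left hjQ (by linarith : (0 : ℚ) ≤ 2 * k - 1)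
    linarith
  have := lt_of_le_of_lt key hn
  exact_mod_cast this

lemma bddB (n k : ℕ) : BddBelow {x : ℝ | ∃ a b r s : ℕ, InB n k a b r s ∧
    x = max ((k : ℝ) * ((a : ℝ) + (r : ℝ) / (s : ℝ)))
            ((k : ℝ) * ((b : ℝ) - (r : ℝ) / (s : ℝ)))} := by
  refine ⟨0, ?_⟩
  rintro x ⟨a, b, r, s, _, rfl⟩
  exact le_max_of_le_left (by positivity)

lemma Nval_le (n k g : ℕ) (hk : 2 ≤ k) (hg : gammaF k = g + 1) : Nval n k ≤ k * g := by
  obtain ⟨h2, _, h3⟩ := gamma_spec k hk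
  rw [hg] at h2 h3
  have hg1 : (1 : ℝ) ≤ g := by exact_mod_cast (by omega : 1 ≤ g)
  apply csInf_le (bddB n k)
  refine ⟨g, 1, 0, 1, ⟨by omega, by omega, by simp, by simp, ?_⟩, ?_⟩
  · rintro ⟨z, hz⟩
    apply h3
    have e : (k : ℝ) = z * (g + 1) := by
      rw [← hz]; field_simp; simp
    have e2 : (k : ℤ) = z * ((g + 1 : ℕ) : ℤ) := by exact_mod_cast e
    exact Int.natCast_dvd_natCast.mp ⟨z, by rw [e2, mul_comm]⟩
  · simp only [Nat.cast_zero, zero_div, add_zero, sub_zero, Nat.cast_one]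
    rw [max_eq_left]
    gcongr

lemma le_maxNorm (n k : ℕ) (u : Fin n → ℝ) (A : Finset (Fin n)) (hA : A.card = k) :
    |∑ i ∈ A, u i| ≤ maxNormJ n k u :=
  le_ciSup (f := fun A : {A : Finset (Fin n) // A.card = k} => |∑ i ∈ A.1, u i|)
    (Set.finite_range _).bddAbove ⟨A, hA⟩

lemma feas_int (n k : ℕ) (hk : 2 ≤ k) (hkn : k < n) (u : Fin n → ℝ) (hu : KFeasible n k u) :
    ∀ i j, ∃ z : ℤ, u i - u j = z := by
  intro i j
  by_cases hij : i = j
  · exact ⟨0, by simp [hij]⟩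
  obtain ⟨B, hB, hBc⟩ := Finset.exists_subset_card_eq
    (s := (Finset.univ.erase i).erase j) (n := k - 1) (by
      rw [Finset.card_erase_of_mem (by simp [Ne.symm hij]), Finset.card_erase_of_mem (by simp)]
      simp; omega)
  have hi : i ∉ B := fun h => by simpa using hB h
  have hj : j ∉ B := fun h => by simpa using hB h
  obtain ⟨z, _, hz⟩ := hu.2 (insert i B) (by rw [Finset.card_insert_of_notMem hi]; omega)
  obtain ⟨w, _, hw⟩ := hu.2 (insert j B) (by rw [Finset.card_insert_of_notMem hj]; omega)
  rw [Finset.sum_insert hi] at hz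
  rw [Finset.sum_insert hj] at hw
  exact ⟨z - w, by push_cast; linarith⟩

lemma card_mul_int {n : ℕ} (u : Fin n → ℝ) (hint : ∀ i j, ∃ z : ℤ, u i - u j = z)
    (A : Finset (Fin n)) (i : Fin n) (w : ℤ) (hA : ∑ j ∈ A, u j = w) :
    ∃ z : ℤ, (A.card : ℝ) * u i = z := by
  choose f hf using hint
  refine ⟨∑ j ∈ A, f i j + w, ?_⟩
  push_cast
  rw [← hA, ← Finset.sum_add_distrib]
  simp_rw [← hf]
  simp

lemma rs_exist (n k : ℕ) (hk : 0 < k) (hn : 0 < n) (c : ℝ)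
    (h1 : ∃ z : ℤ, (k : ℝ) * c = z) (h2 : ∃ z : ℤ, (n : ℝ) * c = z) :
    ∃ r s : ℕ, r < s ∧ Nat.gcd r s = 1 ∧ s ∣ Nat.gcd n k ∧
      ∃ z : ℤ, c = (r : ℝ) / (s : ℝ) + z := by
  obtain ⟨z, hz⟩ := h1
  obtain ⟨w, hw⟩ := h2
  have hkR : (k : ℝ) ≠ 0 := by positivity
  have hnR : (n : ℝ) ≠ 0 := by positivity
  set q : ℚ := (z : ℚ) / (k : ℚ) with hq
  have hqc : (q : ℝ) = c := by
    rw [hq]; push_cast; rw [← hz]; field_simp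
  have hq2 : q = (w : ℚ) / (n : ℚ) := by
    have : (q : ℝ) = ((w : ℚ) / (n : ℚ) : ℚ) := by
      rw [hqc]; push_cast; rw [← hw]; field_simp
    exact_mod_cast this
  have d1 : q.den ∣ k := by
    have := Rat.den_dvd z (k : ℤ)
    rw [Rat.divInt_eq_div] at this
    rw [hq]
    exact_mod_cast this
  have d2 : q.den ∣ n := by
    have := Rat.den_dvd w (n : ℤ)
    rw [Rat.divInt_eq_div] at this
    rw [hq2]
    exact_mod_cast this
  have hd0 : (q.den : ℤ) ≠ 0 := by exact_mod_cast q.den_nz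
  have hr : ((q.num % (q.den : ℤ)).toNat : ℤ) = q.num % (q.den : ℤ) :=
    Int.toNat_of_nonneg (Int.emod_nonneg _ hd0)
  refine ⟨(q.num % (q.den : ℤ)).toNat, q.den, ?_, ?_, Nat.dvd_gcd d2 d1, q.num / (q.den : ℤ), ?_⟩
  · have := Int.emod_lt_of_pos q.num (by exact_mod_cast q.den_pos : (0 : ℤ) < q.den)
    omega
  · have h : Int.gcd ((q.num % (q.den : ℤ)).toNat : ℤ) (q.den : ℤ) = 1 := by
      rw [hr, Int.gcd_emod]
      exact q.reduced
    exact h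
  · have e := Int.emod_add_mul_ediv q.num (q.den : ℤ)
    rw [← hr] at e
    have eR : (((q.num % (q.den : ℤ)).toNat : ℕ) : ℝ) + (q.den : ℝ) * ((q.num / (q.den : ℤ) : ℤ) : ℝ)
      = (q.num : ℝ) := by exact_mod_cast e
    have hdR : (q.den : ℝ) ≠ 0 := by exact_mod_cast q.den_nz
    have e3 : c = (q.num : ℝ) / (q.den : ℝ) := by
      rw [← hqc]; exact Rat.cast_def q
    rw [e3, ← eR]
    field_simp

lemma pair_bound (n k : ℕ) (hk : 2 ≤ k) (hkn : k < n) (u : Fin n → ℝ) (hu : KFeasible n k u)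
    (x y : ℝ) (hx : x < 0) (hy : 0 < y)
    (hxp : k ≤ (Finset.univ.filter (fun i => u i = x)).card)
    (hyp : k ≤ (Finset.univ.filter (fun i => u i = y)).card) :
    Nval n k ≤ maxNormJ n k u := by
  have hint := feas_int n k hk hkn u hu
  obtain ⟨X, hX, hXc⟩ := Finset.exists_subset_card_eq hxp
  obtain ⟨Y, hY, hYc⟩ := Finset.exists_subset_card_eq hyp
  have hXv : ∀ i ∈ X, u i = x := fun i hi => (Finset.mem_filter.mp (hX hi)).2
  have hYv : ∀ i ∈ Y, u i = y := fun i hi => (Finset.mem_filter.mp (hY hi)).2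
  have hXY : Disjoint X Y := by
    rw [Finset.disjoint_left]
    intro i h1 h2
    have := hXv i h1
    have := hYv i h2
    linarith
  obtain ⟨i, hi⟩ : X.Nonempty := by rw [← Finset.card_pos]; omega
  obtain ⟨j, hj⟩ : Y.Nonempty := by rw [← Finset.card_pos]; omega
  obtain ⟨w, _, hw⟩ := hu.2 X hXc
  have k1 := card_mul_int u hint X i w hw
  have k2 := card_mul_int u hint Finset.univ i 0 (by simpa using hu.1)
  rw [hXc] at k1
  rw [Finset.card_univ, Fintype.card_fin] at k2
  obtain ⟨r, s, hrs, hg, hd, z, hz⟩ := rs_exist n k (by omega) (by omega) (u i) k1 k2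
  obtain ⟨d, hd2⟩ := hint j i
  rw [hXv i hi] at hz hd2
  rw [hYv j hj] at hd2
  have hsR : (0 : ℝ) < s := by exact_mod_cast (by omega : 0 < s)
  have hf0 : (0 : ℝ) ≤ (r : ℝ) / s := by positivity
  have hf1 : (r : ℝ) / s < 1 := by
    rw [div_lt_one hsR]; exact_mod_cast hrs
  have hzneg : z < 0 := by
    have : (z : ℝ) < 0 := by linarith
    exact_mod_cast this
  have hzd : 0 ≤ z + d := by
    have : (-1 : ℝ) < z + d := by linarith
    have : (-1 : ℤ) < z + d := by exact_mod_cast this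
    omega
  obtain ⟨a, ha⟩ := Int.eq_ofNat_of_zero_le hzd
  obtain ⟨b, hb⟩ := Int.eq_ofNat_of_zero_le (by omega : 0 ≤ -z)
  have haR : (a : ℝ) = z + d := by exact_mod_cast ha.symm
  have hbR : (b : ℝ) = -z := by exact_mod_cast hb.symm
  have ey : y = a + (r : ℝ) / s := by linarith
  have ex : -x = b - (r : ℝ) / s := by linarith
  have hkR : (0 : ℝ) < k := by exact_mod_cast (by omega : 0 < k)
  have hab : (0 : ℝ) < a + b := by linarith
  have hmem : Nval n k ≤ max ((k : ℝ) * ((a : ℝ) + (r : ℝ) / (s : ℝ)))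
            ((k : ℝ) * ((b : ℝ) - (r : ℝ) / (s : ℝ))) := by
    apply csInf_le (bddB n k)
    refine ⟨a, b, r, s, ⟨by omega, hrs, hg, hd, ?_⟩, rfl⟩
    rintro ⟨t, ht⟩
    have ht' : (t : ℝ) * (a + b) = k * (-x) := by
      rw [← ht, ex]; field_simp
    have eab : (a : ℝ) + b = y - x := by linarith
    have t0 : 0 ≤ t := by
      have : (0 : ℝ) < t := by
        by_contra hc
        push Not at hc
        nlinarith [mul_pos hkR (neg_pos.mpr hx)]
      exact_mod_cast this.le
    have tk : t ≤ k := by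
      have : (t : ℝ) ≤ k := by
        by_contra hc
        push Not at hc
        nlinarith [mul_pos hkR hy, mul_lt_mul_of_pos_right hc hab]
      exact_mod_cast this
    obtain ⟨p, hp⟩ := Int.eq_ofNat_of_zero_le t0
    have hpk : p ≤ k := by omega
    obtain ⟨Y', hY', hYc'⟩ := Finset.exists_subset_card_eq (s := Y) (n := p) (by omega)
    obtain ⟨X', hX', hXc'⟩ := Finset.exists_subset_card_eq (s := X) (n := k - p) (by omega)
    have hdis : Disjoint X' Y' := Finset.disjoint_of_subset_left hX'
      (Finset.disjoint_of_subset_right hY' hXY)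
    obtain ⟨v, hv0, hv⟩ := hu.2 (X' ∪ Y') (by
      rw [Finset.card_union_of_disjoint hdis]; omega)
    rw [Finset.sum_union hdis, Finset.sum_congr rfl (fun i hi => hXv i (hX' hi)),
      Finset.sum_congr rfl (fun i hi => hYv i (hY' hi)), Finset.sum_const, Finset.sum_const,
      hXc', hYc', nsmul_eq_mul, nsmul_eq_mul, Nat.cast_sub hpk] at hv
    apply hv0
    have hpR : (p : ℝ) = t := by rw [hp]; simp
    have : (v : ℝ) = 0 := by
      rw [← hv, hpR]
      rw [eab] at ht'
      linarith
    exact_mod_cast this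
  refine hmem.trans (max_le ?_ ?_)
  · rw [← ey]
    refine le_trans (le_of_eq ?_) (le_maxNorm n k u Y hYc)
    rw [Finset.sum_congr rfl hYv, Finset.sum_const, hYc, nsmul_eq_mul, abs_of_pos (by positivity)]
  · rw [← ex]
    refine le_trans (le_of_eq ?_) (le_maxNorm n k u X hXc)
    rw [Finset.sum_congr rfl hXv, Finset.sum_const, hXc, nsmul_eq_mul,
      abs_of_neg (mul_neg_of_pos_of_neg hkR hx)]
    ring

lemma lower_all (n k : ℕ) (hk : 2 ≤ k) (hkn : k < n) (hn : TF k < (n : ℚ)) (u : Fin n → ℝ)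
    (hu : KFeasible n k u) : Nval n k ≤ maxNormJ n k u := by
  by_contra hcon
  push Not at hcon
  obtain ⟨hg2, hgk, _⟩ := gamma_spec k hk
  obtain ⟨g, hg⟩ : ∃ g, gammaF k = g + 1 := ⟨gammaF k - 1, by omega⟩
  have hN := Nval_le n k g hk hg
  have hT := T_bound n k g hk hg hn
  have hint := feas_int n k hk hkn u hu
  have hb : ∀ A : Finset (Fin n), A.card = k → |∑ i ∈ A, u i| ≤ k * g := fun A hA =>
    (le_maxNorm n k u A hA).trans (hcon.le.trans hN)
  have hkint : ∀ i, ∃ z : ℤ, (k : ℝ) * u i = z := by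
    intro i
    obtain ⟨A, _, hA⟩ := Finset.exists_subset_card_eq (s := (Finset.univ : Finset (Fin n))) (n := k)
      (by simp; omega)
    obtain ⟨w, _, hw⟩ := hu.2 A hA
    have := card_mul_int u hint A i w hw
    rwa [hA] at this
  have hz : ∀ x : ℝ, k ≤ (Finset.univ.filter (fun i => u i = x)).card → x ≠ 0 := by
    rintro x hx rfl
    obtain ⟨A, hA, hAc⟩ := Finset.exists_subset_card_eq hx
    obtain ⟨w, hw0, hw⟩ := hu.2 A hAc
    rw [Finset.sum_eq_zero (fun i hi => (Finset.mem_filter.mp (hA hi)).2)] at hw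
    exact hw0 (by exact_mod_cast hw.symm)
  have hX : ∃ x, x ≤ 0 ∧ k ≤ (Finset.univ.filter (fun i => u i = x)).card := by
    by_contra hc
    push Not at hc
    exact core_aux n k g u hk (by omega) hT hu.1 hint hkint hb hc
  have hY : ∃ y, 0 ≤ y ∧ k ≤ (Finset.univ.filter (fun i => u i = y)).card := by
    by_contra hc
    push Not at hc
    refine core_aux n k g (fun i => - u i) hk (by omega) hT (by simp [hu.1]) ?_ ?_ ?_ ?_
    · intro i j
      obtain ⟨z, hz⟩ := hint j i
      exact ⟨z, by rw [← hz]; ring⟩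
    · intro i
      obtain ⟨z, hz⟩ := hkint i
      exact ⟨-z, by push_cast; rw [← hz]; ring⟩
    · intro A hA
      rw [Finset.sum_neg_distrib, abs_neg]
      exact hb A hA
    · intro x hx
      have := hc (-x) (by linarith)
      simpa [neg_eq_iff_eq_neg] using this
  obtain ⟨x, hx0, hx⟩ := hX
  obtain ⟨y, hy0, hy⟩ := hY
  exact absurd (pair_bound n k hk hkn u hu x y (lt_of_le_of_ne hx0 (hz x hx))
    (lt_of_le_of_ne hy0 (hz y hy).symm) hx hy) (not_le.mpr hcon)

lemma feas_exists (n k : ℕ) (hk : 2 ≤ k) (hkn : k < n) : ∃ u : Fin n → ℝ, KFeasible n k u := by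
  let i0 : Fin n := ⟨0, by omega⟩
  have hs : ∀ A : Finset (Fin n), ∑ i ∈ A, (1 - if i = i0 then (n : ℝ) else 0)
      = A.card - if i0 ∈ A then (n : ℝ) else 0 := by
    intro A
    rw [Finset.sum_sub_distrib, Finset.sum_ite_eq']
    simp
  refine ⟨fun i => 1 - if i = i0 then (n : ℝ) else 0, ?_, ?_⟩
  · rw [hs]; simp
  · intro A hA
    rw [hs, hA]
    by_cases h : i0 ∈ A
    · exact ⟨k - n, by omega, by simp [h]⟩
    · exact ⟨k, by omega, by simp [h]⟩

theorem mJ_lower_bound (n k : ℕ) (hk : 2 ≤ k) (hn : TF k < (n : ℚ)) :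
    Nval n k + 1 ≤ (mJ n k : ℝ) ∧
    ∀ u : Fin n → ℝ, KFeasible n k u → Nval n k ≤ maxNormJ n k u := by
  have hkn : k < n := by
    obtain ⟨hg2, hgk, _⟩ := gamma_spec k hk
    obtain ⟨g, hg⟩ : ∃ g, gammaF k = g + 1 := ⟨gammaF k - 1, by omega⟩
    have hT := T_bound n k g hk hg hn
    have hkR : (2 : ℝ) ≤ k := by exact_mod_cast hk
    have h0 : 0 ≤ (k : ℝ) * (k - 1) * (g + 1) ^ 2 :=
      mul_nonneg (mul_nonneg (by linarith) (by linarith)) (by positivity)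
    have h1 : 0 ≤ (2 * (k : ℝ) - 1) * k * (g + 1) :=
      mul_nonneg (mul_nonneg (by linarith) (by linarith)) (by positivity)
    have : (k : ℝ) < n := by linarith
    exact_mod_cast this
  refine ⟨?_, fun u hu => lower_all n k hk hkn hn u hu⟩
  have hne : {m : ℕ | ∃ u : Fin n → ℝ, KFeasible n k u ∧ (m : ℝ) = 1 + maxNormJ n k u}.Nonempty := by
    obtain ⟨u, hu⟩ := feas_exists n k hk hkn
    obtain ⟨A0, _, hA0⟩ := Finset.exists_subset_card_eq (s := (Finset.univ : Finset (Fin n)))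
      (n := k) (by simp; omega)
    haveI : Nonempty {A : Finset (Fin n) // A.card = k} := ⟨⟨A0, hA0⟩⟩
    obtain ⟨A, hA⟩ := exists_eq_ciSup_of_finite
      (f := fun A : {A : Finset (Fin n) // A.card = k} => |∑ i ∈ A.1, u i|)
    obtain ⟨z, _, hz⟩ := hu.2 A.1 A.2
    refine ⟨1 + z.natAbs, u, hu, ?_⟩
    unfold maxNormJ
    rw [← hA]
    simp only [hz]
    push_cast
    rw [Nat.cast_natAbs]
    push_cast
    rfl
  obtain ⟨u, hu, hm⟩ := Nat.sInf_mem hne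
  have h := lower_all n k hk hkn hn u hu
  have hm' : (mJ n k : ℝ) = 1 + maxNormJ n k u := hm
  rw [hm']
  linarith
end

section
/- Let k ≥ 2, let γ be the smallest positive integer that does not divide k, and suppose n > T(k), gcd(n,k) = 1 and γ divides n. Then: (1) if γ = 2 then m(1,J(n,k)) = k + 1; (2) if γ > 2 then m(1,J(n,k)) = (⌊γ/2⌋+1)·k + 1. -/
theorem aux_asym (n k c : ℕ) (hk : 2 ≤ k) (hc : 1 ≤ c) (hn : (c+1)^2 * k < n)
    (v : Fin n → ℤ) (hs : ∑ i, v i = 0)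
    (hlt : ∀ A : Finset (Fin n), A.card = k → |∑ i ∈ A, v i| < c * k)
    (h0 : ∀ b : ℤ, 0 ≤ b → b < c → (Finset.univ.filter (fun i => v i = -b)).card < k) : False := by
  have hP : (Finset.univ.filter (fun i => (c:ℤ) ≤ v i)).card < k := by
    by_contra hcon
    obtain ⟨A, hA, hAk⟩ := Finset.exists_subset_card_eq (not_lt.mp hcon)
    have h1 := (abs_lt.mp (hlt A hAk)).2
    have h2 : A.card • (c:ℤ) ≤ ∑ i ∈ A, v i :=
      Finset.card_nsmul_le_sum _ _ _ (fun i hi => (Finset.mem_filter.mp (hA hi)).2)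
    rw [hAk, nsmul_eq_mul] at h2
    linarith
  set B := Finset.univ.filter (fun i => v i ≤ -(c:ℤ)) with hB
  have hBk : B.card < k := by
    by_contra hcon
    obtain ⟨A, hA, hAk⟩ := Finset.exists_subset_card_eq (not_lt.mp hcon)
    have h1 := (abs_lt.mp (hlt A hAk)).1
    have h2 : ∑ i ∈ A, v i ≤ A.card • (-(c:ℤ)) :=
      Finset.sum_le_card_nsmul _ _ _ (fun i hi => (Finset.mem_filter.mp (hA hi)).2)
    rw [hAk, nsmul_eq_mul] at h2
    linarith
  have hnk : 4 * k < n := by nlinarith [Nat.mul_le_mul_right k (Nat.pow_le_pow_left (show 2 ≤ c+1 by omega) 2)]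
  set C := Finset.univ.filter (fun i => ¬ (c:ℤ) ≤ v i) with hC
  have hCc : k ≤ C.card := by
    have := Finset.card_filter_add_card_filter_not (s := (Finset.univ : Finset (Fin n))) (fun i => (c:ℤ) ≤ v i)
    rw [Finset.card_univ, Fintype.card_fin] at this
    have hCe : (Finset.univ.filter (fun i => ¬ (c:ℤ) ≤ v i)).card = C.card := by
      rw [hC]
    omega
  have hBC : B ⊆ C := by
    intro i hi
    simp only [hB, hC, Finset.mem_filter, Finset.mem_univ, true_and] at hi ⊢
    omega
  obtain ⟨A, hBA, hAC, hAk⟩ := Finset.exists_subsuperset_card_eq hBC hBk.le hCc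
  have hBsum : -(2 * c * k : ℤ) ≤ ∑ i ∈ B, v i := by
    have h1 := (abs_lt.mp (hlt A hAk)).1
    have h2 : ∑ i ∈ A \ B, v i ≤ (A \ B).card • (c:ℤ) :=
      Finset.sum_le_card_nsmul _ _ _ (fun i hi => by
        have := hAC (Finset.mem_sdiff.mp hi).1
        simp only [hC, Finset.mem_filter, Finset.mem_univ, true_and] at this
        omega)
    have h3 := Finset.sum_sdiff (f := v) hBA
    have h4 : (A \ B).card ≤ k := hAk ▸ Finset.card_le_card Finset.sdiff_subset
    rw [nsmul_eq_mul] at h2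
    have h5 : ((A \ B).card : ℤ) * c ≤ k * c := by
      exact_mod_cast Nat.mul_le_mul_right c h4
    linarith
  set N := Finset.univ.filter (fun i => -(c:ℤ) < v i ∧ v i ≤ 0) with hN
  have hNc : N.card ≤ k * c := by
    have := Finset.card_le_mul_card_image_of_maps_to (s := N) (t := Finset.Ioc (-(c:ℤ)) 0) (f := v)
      (fun i hi => by simpa [hN] using hi) k (fun x hx => by
        have hx' := Finset.mem_Ioc.mp hx
        have := h0 (-x) (by omega) (by omega)
        rw [neg_neg] at this
        refine le_trans (Finset.card_le_card ?_) this.le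
        exact Finset.filter_subset_filter _ (Finset.subset_univ _))
    simpa using this
  have hsplit := Finset.sum_add_sum_compl B v
  have hcompl : ∑ i ∈ Bᶜ, (1 - (c:ℤ) * (if i ∈ N then 1 else 0)) ≤ ∑ i ∈ Bᶜ, v i := by
    refine Finset.sum_le_sum (fun i hi => ?_)
    simp only [hB, Finset.mem_compl, Finset.mem_filter, Finset.mem_univ, true_and] at hi
    split_ifs with h
    · omega
    · simp only [hN, Finset.mem_filter, Finset.mem_univ, true_and] at h
      simp; omega
  rw [Finset.sum_sub_distrib, ← Finset.mul_sum, Finset.sum_boole] at hcompl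
  simp only [Finset.sum_const, Finset.card_compl, Fintype.card_fin, nsmul_eq_mul, mul_one] at hcompl
  have h6 : (Finset.filter (fun i => i ∈ N) Bᶜ).card ≤ k * c := by
    refine le_trans (Finset.card_le_card ?_) hNc
    intro i hi
    exact (Finset.mem_filter.mp hi).2
  have h7 : (c:ℤ) * ((Finset.filter (fun i => i ∈ N) Bᶜ).card : ℤ) ≤ c * (k * c) := by
    exact_mod_cast Nat.mul_le_mul_left c h6
  have h8 : ((n - B.card : ℕ) : ℤ) ≥ n - k := by omega
  have h9 : ((c:ℤ)+1)^2 * k < n := by exact_mod_cast hn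
  nlinarith

theorem aux_lower (n k c : ℕ) (hk : 2 ≤ k) (hc : 1 ≤ c) (hn : (c+1)^2 * k < n)
    (hd : ∀ s, 0 < s → s + 2 ≤ 2 * c → s ∣ k)
    (v : Fin n → ℤ) (hs : ∑ i, v i = 0)
    (hne : ∀ A : Finset (Fin n), A.card = k → ∑ i ∈ A, v i ≠ 0)
    (hlt : ∀ A : Finset (Fin n), A.card = k → |∑ i ∈ A, v i| < c * k) : False := by
  have hz : (Finset.univ.filter (fun i => v i = 0)).card < k := by
    by_contra hcon
    obtain ⟨A, hA, hAk⟩ := Finset.exists_subset_card_eq (not_lt.mp hcon)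
    exact hne A hAk (Finset.sum_eq_zero (fun i hi => (Finset.mem_filter.mp (hA hi)).2))
  by_cases h : ∀ b : ℤ, 0 ≤ b → b < c → (Finset.univ.filter (fun i => v i = -b)).card < k
  · exact aux_asym n k c hk hc hn v hs hlt h
  push Not at h
  obtain ⟨b, hb0, hbc, hbk⟩ := h
  refine aux_asym n k c hk hc hn (fun i => - v i) (by simp [hs]) ?_ ?_
  · intro A hA
    rw [Finset.sum_neg_distrib, abs_neg]
    exact hlt A hA
  intro a ha0 hac
  by_contra hcon
  push Not at hcon
  simp only [neg_inj] at hcon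
  have hb : b ≠ 0 := by
    rintro rfl
    rw [neg_zero] at hbk
    omega
  have ha : a ≠ 0 := by
    rintro rfl
    omega
  lift a to ℕ using ha0
  lift b to ℕ using hb0
  obtain ⟨q, hq⟩ := hd (a + b) (by omega) (by omega)
  obtain ⟨X, hX, hXk⟩ := Finset.exists_subset_card_eq (show q * b ≤ _ from le_trans (by nlinarith) hcon)
  obtain ⟨Y, hY, hYk⟩ := Finset.exists_subset_card_eq (show q * a ≤ _ from le_trans (by nlinarith) hbk)
  have hX' : ∀ i ∈ X, v i = a := fun i hi => (Finset.mem_filter.mp (hX hi)).2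
  have hY' : ∀ i ∈ Y, v i = -b := fun i hi => (Finset.mem_filter.mp (hY hi)).2
  have hdis : Disjoint X Y := by
    rw [Finset.disjoint_left]
    intro i h1 h2
    have := hX' i h1
    have := hY' i h2
    omega
  refine hne (X ∪ Y) ?_ ?_
  · rw [Finset.card_union_of_disjoint hdis, hXk, hYk, hq]; ring
  · rw [Finset.sum_union hdis, Finset.sum_congr rfl hX', Finset.sum_congr rfl hY']
    simp only [Finset.sum_const, hXk, hYk, nsmul_eq_mul]
    push_cast; ring

theorem aux_int (n k : ℕ) (hk : 2 ≤ k) (hn : k < n) (hcop : Nat.gcd n k = 1) (u : Fin n → ℝ)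
    (hu : KFeasible n k u) : ∃ v : Fin n → ℤ, ∀ i, u i = v i := by
  obtain ⟨hs, hA⟩ := hu
  let o : Fin n := ⟨0, by omega⟩
  have hdiff : ∀ i, ∃ d : ℤ, u i = u o + d := by
    intro i
    by_cases hi : i = o
    · exact ⟨0, by simp [hi]⟩
    have hcard : k - 1 ≤ (({i, o} : Finset (Fin n))ᶜ).card := by
      rw [Finset.card_compl, Fintype.card_fin, Finset.card_pair hi]; omega
    obtain ⟨S, hS, hSk⟩ := Finset.exists_subset_card_eq hcard
    have hiS : i ∉ S := fun h => by have := hS h; simp at this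
    have hoS : o ∉ S := fun h => by have := hS h; simp at this
    obtain ⟨z1, -, h1⟩ := hA (insert i S) (by rw [Finset.card_insert_of_notMem hiS]; omega)
    obtain ⟨z2, -, h2⟩ := hA (insert o S) (by rw [Finset.card_insert_of_notMem hoS]; omega)
    rw [Finset.sum_insert hiS] at h1
    rw [Finset.sum_insert hoS] at h2
    exact ⟨z1 - z2, by push_cast; linarith⟩
  choose d hd using hdiff
  obtain ⟨A, -, hAk⟩ := Finset.exists_subset_card_eq
    (show k ≤ (Finset.univ : Finset (Fin n)).card by simpa using hn.le)
  obtain ⟨z, -, hz⟩ := hA A hAk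
  rw [Finset.sum_congr rfl (fun i _ => hd i)] at hs hz
  rw [Finset.sum_add_distrib, Finset.sum_const, nsmul_eq_mul] at hs hz
  rw [Finset.card_univ, Fintype.card_fin] at hs
  rw [hAk] at hz
  have hbez := Nat.gcd_eq_gcd_ab n k
  rw [hcop] at hbez
  have hbez' : (1:ℝ) = n * (Nat.gcdA n k) + k * (Nat.gcdB n k) := by exact_mod_cast hbez
  have h0 : u o = ((Nat.gcdA n k * (-∑ i, d i) + Nat.gcdB n k * (z - ∑ i ∈ A, d i) : ℤ) : ℝ) := by
    push_cast
    linear_combination (u o) * hbez' + (Nat.gcdA n k : ℝ) * hs + (Nat.gcdB n k : ℝ) * hz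
  refine ⟨fun i => (Nat.gcdA n k * (-∑ i, d i) + Nat.gcdB n k * (z - ∑ i ∈ A, d i)) + d i, fun i => ?_⟩
  rw [hd i, h0]; push_cast; ring

theorem aux_constr (n k a b : ℕ) (hb : 1 ≤ b) (hba : b ≤ a) (hcop : Nat.Coprime (a + b) a)
    (hdk : ¬ (a + b) ∣ k) (hdn : (a + b) ∣ n) (hkn : k ≤ n) :
    ∃ u : Fin n → ℝ, KFeasible n k u ∧ maxNormJ n k u ≤ a * k := by
  obtain ⟨t, ht⟩ := hdn
  let v : Fin n → ℤ := fun i => if i.val < b * t then (a:ℤ) else -b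
  refine ⟨fun i => (v i : ℝ), ⟨?_, ?_⟩, ?_⟩
  · have h : ∑ i, v i = 0 := by
      have h1 := Fin.sum_univ_eq_sum_range (fun i : ℕ => if i < b * t then (a:ℤ) else -b) n
      have h2 : ∑ i, v i = _ := h1
      rw [h2, ht, show (a + b) * t = b * t + a * t by ring, Finset.sum_range_add,
        Finset.sum_congr rfl (g := fun _ => (a:ℤ)) (fun i hi => by simp [Finset.mem_range.mp hi])]
      simp
      ring
    beta_reduce
    exact_mod_cast h
  · intro A hA
    refine ⟨∑ i ∈ A, v i, ?_, by push_cast; rfl⟩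
    intro h
    have hd : ((a + b : ℕ) : ℤ) ∣ ∑ i ∈ A, ((a:ℤ) - v i) := by
      refine Finset.dvd_sum (fun i _ => ?_)
      simp only [v]
      split_ifs <;> simp
    rw [Finset.sum_sub_distrib, h, Finset.sum_const, hA, nsmul_eq_mul, sub_zero] at hd
    have hd' : (a + b) ∣ k * a := by exact_mod_cast hd
    exact hdk (hcop.dvd_of_dvd_mul_right hd')
  · obtain ⟨A, -, hAk⟩ := Finset.exists_subset_card_eq
      (show k ≤ (Finset.univ : Finset (Fin n)).card by simpa using hkn)
    have : Nonempty {A : Finset (Fin n) // A.card = k} := ⟨⟨A, hAk⟩⟩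
    refine ciSup_le (fun B => ?_)
    have h1 : |∑ i ∈ B.1, v i| ≤ a * k := by
      refine (Finset.abs_sum_le_sum_abs _ _).trans ?_
      refine (Finset.sum_le_card_nsmul _ _ (a:ℤ) (fun i _ => ?_)).trans ?_
      · simp only [v]
        split_ifs <;> simp <;> omega
      · rw [B.2, nsmul_eq_mul, mul_comm]
    beta_reduce
    exact_mod_cast h1

theorem aux_main (n k c b : ℕ) (hk : 2 ≤ k) (hn : (c+1)^2 * k < n) (hcop : Nat.gcd n k = 1)
    (hd : ∀ s, 0 < s → s + 2 ≤ 2 * c → s ∣ k) (hb : 1 ≤ b) (hba : b ≤ c)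
    (hcp : Nat.Coprime (c + b) c) (hdk : ¬ (c + b) ∣ k) (hdn : (c + b) ∣ n) :
    mJ n k = c * k + 1 := by
  have hkn : k < n := by nlinarith [Nat.mul_le_mul_right k (Nat.pow_le_pow_left (show 2 ≤ c+1 by omega) 2)]
  have hlow : ∀ u, KFeasible n k u → (c * k : ℝ) ≤ maxNormJ n k u := by
    intro u hu
    obtain ⟨v, hv⟩ := aux_int n k hk hkn hcop u hu
    by_contra hcon
    push Not at hcon
    refine aux_lower n k c hk (by omega) hn hd v ?_ ?_ ?_
    · have := hu.1
      simp_rw [hv] at this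
      exact_mod_cast this
    · intro A hA h
      obtain ⟨z, hz, h1⟩ := hu.2 A hA
      simp_rw [hv] at h1
      have h2 : ∑ i ∈ A, v i = z := by exact_mod_cast h1
      exact hz (h2 ▸ h)
    · intro A hA
      have h1 : |∑ i ∈ A, u i| ≤ maxNormJ n k u :=
        le_ciSup (f := fun A : {A : Finset (Fin n) // A.card = k} => |∑ i ∈ A.1, u i|)
          (Set.finite_range _).bddAbove ⟨A, hA⟩
      have h2 := lt_of_le_of_lt h1 hcon
      simp_rw [hv] at h2
      exact_mod_cast h2
  obtain ⟨u, hu, hle⟩ := aux_constr n k c b hb hba hcp hdk hdn hkn.le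
  have hmem : c * k + 1 ∈ {m : ℕ | ∃ u : Fin n → ℝ, KFeasible n k u ∧ (m : ℝ) = 1 + maxNormJ n k u} := by
    refine ⟨u, hu, ?_⟩
    rw [le_antisymm hle (hlow u hu)]
    push_cast; ring
  refine le_antisymm (Nat.sInf_le hmem) (le_csInf ⟨_, hmem⟩ ?_)
  rintro m ⟨w, hw, hm⟩
  have := hlow w hw
  have h : ((c * k + 1 : ℕ) : ℝ) ≤ m := by rw [hm]; push_cast; linarith
  exact_mod_cast h

theorem aux_T (n k c : ℕ) (hk : 2 ≤ k) (hc : 1 ≤ c) (hj : 2 * c * k ≤ jF k) (hn : TF k < (n : ℚ)) :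
    (c+1)^2 * k < n := by
  have hk' : (2:ℚ) ≤ k := by exact_mod_cast hk
  have hc' : (1:ℚ) ≤ c := by exact_mod_cast hc
  have hj' : 2 * (c:ℚ) * k ≤ jF k := by exact_mod_cast hj
  unfold TF at hn
  set j : ℚ := (jF k : ℚ)
  have hck : 0 ≤ (c:ℚ) * k := by positivity
  have h1 : j^2 / k ≤ j^2 / 2 := by gcongr
  have h2 : (2 * (c:ℚ) * k)^2 ≤ j^2 := by gcongr
  have h3 : 0 ≤ (2 * (k:ℚ) - 1) * j := by
    apply mul_nonneg <;> linarith
  have h4 : ((c:ℚ)+1)^2 ≤ (2*c)^2 := by gcongr; linarith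
  have h5 : ((c:ℚ)+1)^2 * k ≤ (2*c)^2 * k := by gcongr
  have h6 : (2*(c:ℚ))^2 * k * 2 ≤ (2*c)^2 * k * k := by gcongr
  have h : (((c+1)^2 * k : ℕ) : ℚ) < n := by
    push_cast
    nlinarith
  exact_mod_cast h

theorem mJ_coprime_case (n k : ℕ) (hk : 2 ≤ k) (hn : TF k < (n : ℚ))
    (hcop : Nat.gcd n k = 1) (hdvd : gammaF k ∣ n) :
    (gammaF k = 2 → mJ n k = k + 1) ∧
    (2 < gammaF k → mJ n k = (gammaF k / 2 + 1) * k + 1) := by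
  have hne : {m : ℕ | 0 < m ∧ ¬ m ∣ k}.Nonempty :=
    ⟨k + 1, by omega, fun h => by have := Nat.le_of_dvd (by omega) h; omega⟩
  have hg : 0 < gammaF k ∧ ¬ gammaF k ∣ k := Nat.sInf_mem hne
  have hmin : ∀ s, 0 < s → s < gammaF k → s ∣ k := by
    intro s hs hlt
    by_contra hcon
    exact Nat.notMem_of_lt_sInf hlt ⟨hs, hcon⟩
  constructor
  · intro h2
    rw [h2] at hg hdvd
    have hodd : Odd k := Nat.not_even_iff_odd.mp (fun h => hg.2 h.two_dvd)
    have hT := aux_T n k 1 hk le_rfl (by simp [jF, hodd]) hn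
    have := aux_main n k 1 1 hk hT hcop (by intro s; omega) le_rfl le_rfl (by norm_num) hg.2 hdvd
    simpa using this
  · intro h2
    have hev : 2 ∣ k := hmin 2 (by norm_num) h2
    have hnodd : ¬ 2 ∣ n := fun h => by
      have := Nat.dvd_gcd h hev
      omega
    have hgodd : ¬ 2 ∣ gammaF k := fun h => hnodd (h.trans hdvd)
    have hko : ¬ Odd k := Nat.not_odd_iff_even.mpr (even_iff_two_dvd.mpr hev)
    have hsum : gammaF k / 2 + 1 + gammaF k / 2 = gammaF k := by omega
    have hT := aux_T n k (gammaF k / 2 + 1) hk (by omega) (by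
      simp only [jF, hko, if_false]; nlinarith) hn
    refine aux_main n k (gammaF k / 2 + 1) (gammaF k / 2) hk hT hcop ?_ (by omega) (by omega) ?_
      (by rw [hsum]; exact hg.2) (by rw [hsum]; exact hdvd)
    · intro s h1 h3
      exact hmin s h1 (by omega)
    · simp
end
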